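/- Let (G,E) be a self-similar action. The following are equivalent: (Evr) if g ∈ G fixes every path in s(g)E^* (i.e. g·μ = μ for all μ ∈ s(g)E^*), then g strongly fixes some path in s(g)E^*; (1) the inverse semigroup S(G,E) is quasi-fundamental; (2) the inverse semigroup S₀(G,E) is topologically free; (3) the inverse semigroup S₀₀(G,E) is topologically free. Moreover, S(G,E) is fundamental if and only if the self-similar action is faithful (g·μ = μ for all μ ∈ s(g)E^* implies g ∈ G⁰). -/

import Mathlib

noncomputable section

attribute [local instance] Classical.propDecidable

/-- Raw algebraic data of an inverse semigroup with zero, together with a domain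
predicate singling out its genuine elements (the carrier may contain junk). -/
structure RawSem (T : Type) where
  mul : T → T → T
  star : T → T
  zero : T
  dom : T → Prop

namespace RawSem

variable {T : Type} (R : RawSem T)

/-- The natural partial order: `t ≤ u` iff `t = u ⬝ t* ⬝ t`. -/
def le (t u : T) : Prop := t = R.mul u (R.mul (R.star t) t)

/-- Nonzero idempotents (belonging to the domain). -/
def NzIdem (e : T) : Prop := R.dom e ∧ R.mul e e = e ∧ e ≠ R.zero

/-- `F` covers the idempotent `e`: every nonzero idempotent below `e` meets some `f ∈ F`. -/
def Covers (F : Set T) (e : T) : Prop :=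
  ∀ z, R.NzIdem z → R.le z e → ∃ f ∈ F, R.mul z f ≠ R.zero

/-- The set `F_t` of nonzero idempotents trivially fixed by `t`, i.e. `≤ t`. -/
def TrivFix (t : T) : Set T := {e | R.NzIdem e ∧ R.le e t}

/-- The idempotent `e` is fixed by `t`:
`(t ⬝ f ⬝ t*) ⬝ f ≠ 0` for every nonzero idempotent `f ≤ e`. -/
def FixedBy (e t : T) : Prop :=
  ∀ f, R.NzIdem f → R.le f e → R.mul (R.mul (R.mul t f) (R.star t)) f ≠ R.zero

/-- The inverse semigroup is closed. -/
def Closed : Prop :=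
  ∀ t, R.dom t → ∃ F : Finset T, ↑F ⊆ R.TrivFix t ∧ ∀ e ∈ R.TrivFix t, R.Covers ↑F e

/-- The inverse semigroup is topologically free. -/
def TopFree : Prop :=
  ∀ t e, R.dom t → R.NzIdem e → R.FixedBy e t → ∃ f ∈ R.TrivFix t, R.mul f e ≠ R.zero

/-- The inverse semigroup is effective. -/
def Effective : Prop :=
  ∀ t e, R.dom t → R.NzIdem e → R.FixedBy e t →
    ∃ F : Finset T, ↑F ⊆ R.TrivFix t ∧ R.Covers (↑F) e

/-- The inverse semigroup is minimal. -/
def Minimal : Prop :=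
  ∀ e f, R.NzIdem e → R.NzIdem f → ∃ Ts : Finset T, (∀ t ∈ Ts, R.dom t) ∧
    R.Covers ((fun t => R.mul (R.mul t f) (R.star t)) '' ↑Ts) e

/-- The inverse semigroup is quasi-fundamental. -/
def QuasiFund : Prop :=
  ∀ s t, R.dom s → R.dom t → s ≠ R.zero → t ≠ R.zero →
    (∀ e, R.NzIdem e → R.mul (R.mul s e) (R.star s) = R.mul (R.mul t e) (R.star t)) →
    ∃ u, R.dom u ∧ u ≠ R.zero ∧ R.le u s ∧ R.le u t

/-- The inverse semigroup is fundamental. -/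
def Fund : Prop :=
  ∀ s t, R.dom s → R.dom t →
    (∀ e, R.NzIdem e → R.mul (R.mul s e) (R.star s) = R.mul (R.mul t e) (R.star t)) → s = t

/-- The inverse semigroup is `E*`-unitary. -/
def EUnitary : Prop := ∀ t e, R.dom t → R.NzIdem e → R.le e t → R.mul t t = t

/-- The inverse semigroup is locally contracting. -/
def LocContr : Prop :=
  ∀ e, R.NzIdem e → ∃ s, R.dom s ∧ ∃ F : Finset T, ∃ f₀ ∈ F,
    (∀ f ∈ F, R.NzIdem f ∧ R.le f (R.mul e (R.mul (R.star s) s))) ∧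
    ∀ f ∈ F, R.Covers (↑F) (R.mul (R.mul s f) (R.star s)) ∧
      R.mul f₀ (R.mul (R.mul s f) (R.star s)) = R.zero

/-- The inverse semigroup is strongly locally contracting. -/
def StrLocContr : Prop :=
  ∀ e, R.NzIdem e → ∃ s f₀ f₁, R.dom s ∧ R.NzIdem f₀ ∧ R.NzIdem f₁ ∧
    R.le f₀ f₁ ∧ R.le f₁ (R.mul e (R.mul (R.star s) s)) ∧
    R.le (R.mul (R.mul s f₁) (R.star s)) f₁ ∧
    R.mul f₀ (R.mul (R.mul s f₁) (R.star s)) = R.zero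

end RawSem

/-- A self-similar action `(G, E)` of a discrete groupoid `G` on a directed graph `E`
sharing the vertex/unit set `V`, encoded by total operations together with axioms
that hold on composable inputs.  Arrows `g` have source `gs g` and range `gr g`;
edges `e` have source `es e` and range `er e`; `g · e` (written `act g e`) and
`g |_e` (written `res g e`) are meaningful when `gs g = er e`. -/
structure SSA where
  V : Type
  G : Type
  E : Type
  gs : G → V
  gr : G → V
  es : E → V
  er : E → V
  one : V → G
  mul : G → G → G
  inv : G → G
  act : G → E → E
  res : G → E → G
  gs_one : ∀ v, gs (one v) = v
  gr_one : ∀ v, gr (one v) = v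
  gs_mul : ∀ g h, gs g = gr h → gs (mul g h) = gs h
  gr_mul : ∀ g h, gs g = gr h → gr (mul g h) = gr g
  mul_assoc' : ∀ g h k, gs g = gr h → gs h = gr k → mul (mul g h) k = mul g (mul h k)
  one_mul' : ∀ g, mul (one (gr g)) g = g
  mul_one' : ∀ g, mul g (one (gs g)) = g
  gs_inv : ∀ g, gs (inv g) = gr g
  gr_inv : ∀ g, gr (inv g) = gs g
  mul_inv' : ∀ g, mul g (inv g) = one (gr g)
  inv_mul' : ∀ g, mul (inv g) g = one (gs g)
  er_act : ∀ g e, gs g = er e → er (act g e) = gr g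
  act_one : ∀ e, act (one (er e)) e = e
  act_mul : ∀ g h e, gs g = gr h → gs h = er e → act (mul g h) e = act g (act h e)
  gs_res : ∀ g e, gs g = er e → gs (res g e) = es e
  gr_res : ∀ g e, gs g = er e → gr (res g e) = es (act g e)
  res_mul : ∀ g h e, gs g = gr h → gs h = er e →
    res (mul g h) e = mul (res g (act h e)) (res h e)

namespace SSA

/-- Finite paths in the graph: `Pth S a b` is the type of paths with range `a`
and source `b`; `cons e p` is the path `e · p`. -/
inductive Pth (S : SSA) : S.V → S.V → Type
  | nil (v : S.V) : Pth S v v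
  | cons (e : S.E) {b : S.V} (p : Pth S (S.es e) b) : Pth S (S.er e) b

/-- The path category `E^*`, bundled: a finite path with its range and source. -/
structure Path (S : SSA) where
  rng : S.V
  src : S.V
  pth : S.Pth rng src

/-- Infinite paths: sequences of edges `e₁e₂⋯` with `es eᵢ = er e_{i+1}`. -/
structure InfPath (S : SSA) where
  seq : ℕ → S.E
  chain : ∀ n, S.es (seq n) = S.er (seq (n + 1))

/-- A twist `σ = (σ_G, σ_⋈)` of the self-similar action, with values in the
unit circle `𝕋 ⊆ ℂ`. -/
structure Twist (S : SSA) where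
  σG : S.G → S.G → ℂ
  σB : S.G → S.E → ℂ
  σG_unimod : ∀ g h, S.gs g = S.gr h → ‖σG g h‖ = 1
  σB_unimod : ∀ g e, S.gs g = S.er e → ‖σB g e‖ = 1
  σG_cocycle : ∀ g h k, S.gs g = S.gr h → S.gs h = S.gr k →
    σG g h * σG (S.mul g h) k = σG h k * σG g (S.mul h k)
  σG_one_left : ∀ g, σG (S.one (S.gr g)) g = 1
  σG_one_right : ∀ g, σG g (S.one (S.gs g)) = 1
  σB_one : ∀ e, σB (S.one (S.er e)) e = 1
  σB_cocycle : ∀ g h e, S.gs g = S.gr h → S.gs h = S.er e →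
    σB h e * (starRingEnd ℂ) (σB (S.mul g h) e) * σB g (S.act h e) =
      (starRingEnd ℂ) (σG (S.res g (S.act h e)) (S.res h e)) * σG g h

variable {S : SSA}

namespace Pth

def length : ∀ {a b : S.V}, S.Pth a b → ℕ
  | _, _, .nil _ => 0
  | _, _, .cons _ p => length p + 1

def toList : ∀ {a b : S.V}, S.Pth a b → List S.E
  | _, _, .nil _ => []
  | _, _, .cons e p => e :: toList p

def comp : ∀ {a b c : S.V}, S.Pth a b → S.Pth b c → S.Pth a c
  | _, _, _, .nil _, q => q
  | _, _, _, .cons e p, q => .cons e (comp p q)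

end Pth

def Path.length (p : Path S) : ℕ := p.pth.length

def Path.toList (p : Path S) : List S.E := p.pth.toList

/-- A vertex regarded as a path of length `0`. -/
def Path.vert (S : SSA) (v : S.V) : Path S := ⟨v, v, .nil v⟩

/-- An edge regarded as a path of length `1`. -/
def Path.ofEdge (S : SSA) (e : S.E) : Path S := ⟨S.er e, S.es e, .cons e (.nil (S.es e))⟩

/-- Concatenation of paths (junk -- the first path -- when not composable). -/
def Path.comp (p q : Path S) : Path S :=
  if h : p.src = q.rng then
    ⟨p.rng, q.src, Pth.comp (cast (congrArg (S.Pth p.rng) h) p.pth) q.pth⟩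
  else p

/-- `q` is a prefix of `p`, i.e. `p` extends `q`. -/
def IsPrefix (S : SSA) (q p : Path S) : Prop :=
  ∃ r : Path S, q.src = r.rng ∧ p = q.comp r

/-- Two paths are comparable if one is a prefix of the other. -/
def Comparable (S : SSA) (p q : Path S) : Prop := IsPrefix S p q ∨ IsPrefix S q p

/-- The extended left action of groupoid arrows on finite paths,
given by the recursive recipe `g · v = r g`, `g · (e μ) = (g · e) (g|_e · μ)`. -/
def pactAux (S : SSA) : ∀ {a b : S.V}, S.G → S.Pth a b → Path S
  | _, _, g, .nil _ => Path.vert S (S.gr g)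
  | _, _, g, .cons e p => (Path.ofEdge S (S.act g e)).comp (pactAux S (S.res g e) p)

/-- The extended left action `g · μ` on finite paths. -/
def pact (S : SSA) (g : S.G) (p : Path S) : Path S := pactAux S g p.pth

/-- The extended restriction map, given by `g|_v = g` and `g|_{e μ} = (g|_e)|_μ`. -/
def presAux (S : SSA) : ∀ {a b : S.V}, S.G → S.Pth a b → S.G
  | _, _, g, .nil _ => g
  | _, _, g, .cons e p => presAux S (S.res g e) p

/-- The extended restriction map `g |_μ` on finite paths. -/
def pres (S : SSA) (g : S.G) (p : Path S) : S.G := presAux S g p.pth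

/-- `g` strongly fixes the path `p` : `g · p = p` and `g|_p = s p`. -/
def SFix (S : SSA) (g : S.G) (p : Path S) : Prop :=
  S.gs g = p.rng ∧ pact S g p = p ∧ pres S g p = S.one p.src

/-- `p` is a minimal strongly `g`-fixed path. -/
def MinSFix (S : SSA) (g : S.G) (p : Path S) : Prop :=
  SFix S g p ∧ ∀ q : Path S, IsPrefix S q p → q ≠ p → ¬ SFix S g q

/-- `g` is a unit of the groupoid (an element of `G⁰`). -/
def IsUnitArrow (S : SSA) (g : S.G) : Prop := g = S.one (S.gs g)

/-- `g` fixes every path in `s(g)E^*`. -/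
def FixesAll (S : SSA) (g : S.G) : Prop :=
  ∀ p : Path S, p.rng = S.gs g → pact S g p = p

/-- Condition (Fin): every `g` admits at most finitely many minimal strongly
`g`-fixed paths. -/
def CondFin (S : SSA) : Prop := ∀ g : S.G, {p : Path S | MinSFix S g p}.Finite

/-- Condition (Evr): if `g` fixes every path in `s(g)E^*` then `g` strongly fixes
some path in `s(g)E^*`. -/
def CondEvr (S : SSA) : Prop := ∀ g : S.G, FixesAll S g → ∃ p : Path S, SFix S g p

/-- `p` is a `g`-cycle: a path of positive length with `g · s(p) = r(p)`. -/
def GCycle (S : SSA) (g : S.G) (p : Path S) : Prop :=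
  1 ≤ p.length ∧ S.gs g = p.src ∧ S.gr g = p.rng

/-- The vertex `v` receives at least two distinct edges. -/
def HasEntranceVert (S : SSA) (v : S.V) : Prop :=
  ∃ e f : S.E, e ≠ f ∧ S.er e = v ∧ S.er f = v

/-- Base vertices of a finite path. -/
def Path.baseVerts (p : Path S) : Set S.V :=
  insert p.rng {v : S.V | ∃ e ∈ p.toList, S.es e = v}

/-- A finite path has an entrance. -/
def Path.hasEntrance (p : Path S) : Prop := ∃ v ∈ p.baseVerts, HasEntranceVert S v

/-- Condition (Cyc): every `G`-cycle has an entrance. -/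
def CondCyc (S : SSA) : Prop := ∀ (g : S.G) (p : Path S), GCycle S g p → p.hasEntrance

/-- `g` has slack. -/
def HasSlack (S : SSA) (g : S.G) : Prop :=
  ∃ F : Finset (Path S), (∀ p ∈ F, SFix S g p) ∧
    ∀ q : Path S, q.rng = S.gs g → ∃ p ∈ F, Comparable S p q

/-- Condition (Sla): if `g` fixes every path in `s(g)E^*` then `g` has slack. -/
def CondSla (S : SSA) : Prop := ∀ g : S.G, FixesAll S g → HasSlack S g

def InfPath.rng (ξ : InfPath S) : S.V := S.er (ξ.seq 0)

/-- Base vertices of an infinite path. -/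
def InfPath.baseVerts (ξ : InfPath S) : Set S.V := {v : S.V | ∃ n, S.er (ξ.seq n) = v}

/-- An infinite path has an entrance. -/
def InfPath.hasEntrance (ξ : InfPath S) : Prop := ∃ v ∈ ξ.baseVerts, HasEntranceVert S v

/-- The finite path `p` is a prefix of the infinite path `ξ`. -/
def PrefixOfInf (S : SSA) (p : Path S) (ξ : InfPath S) : Prop :=
  p.rng = ξ.rng ∧ ∀ i : ℕ, i < p.length → p.toList[i]? = some (ξ.seq i)

/-- Finite or infinite paths. -/
abbrev GenPath (S : SSA) : Type := Path S ⊕ InfPath S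

/-- The finite path `p` is a prefix of the finite or infinite path `ξ`. -/
def GPrefix (S : SSA) (p : Path S) : GenPath S → Prop
  | .inl q => IsPrefix S p q
  | .inr ξ => PrefixOfInf S p ξ

/-- The set `vE¹` of edges received by the vertex `v`. -/
def recvSet (S : SSA) (v : S.V) : Set S.E := {e : S.E | S.er e = v}

/-- A vertex is singular if it is a source or an infinite receiver. -/
def Singular (S : SSA) (v : S.V) : Prop := recvSet S v = ∅ ∨ (recvSet S v).Infinite

/-- A vertex is regular if it is not singular. -/
def Regular (S : SSA) (v : S.V) : Prop := ¬ Singular S v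

/-- The preorder `v ≪ w`: there is `v'` with `vE^*v' ≠ ∅` and `v'Gw ≠ ∅`. -/
def ll (S : SSA) (v w : S.V) : Prop :=
  ∃ (p : Path S) (g : S.G), p.rng = v ∧ S.gr g = p.src ∧ S.gs g = w

/-- Cofinality of the self-similar action: for every boundary path (a finite path
with singular source, or an infinite path) and every vertex `v`, some base vertex
`w` of the path satisfies `v ≪ w`. -/
def Cofinal (S : SSA) : Prop :=
  (∀ p : Path S, Singular S p.src → ∀ v : S.V, ∃ w ∈ p.baseVerts, ll S v w) ∧
  (∀ ξ : InfPath S, ∀ v : S.V, ∃ w ∈ ξ.baseVerts, ll S v w)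

def Hereditary (S : SSA) (W : Set S.V) : Prop :=
  ∀ v ∈ W, ∀ p : Path S, p.rng = v → p.src ∈ W

def Saturated (S : SSA) (W : Set S.V) : Prop :=
  ∀ w : S.V, Regular S w → (∀ e : S.E, S.er e = w → S.es e ∈ W) → w ∈ W

def GInvariant (S : SSA) (W : Set S.V) : Prop := ∀ g : S.G, S.gs g ∈ W → S.gr g ∈ W

/-- `(G,E)`-invariant subsets of `E⁰`: `G`-invariant, hereditary and saturated. -/
def SSAInvariant (S : SSA) (W : Set S.V) : Prop :=
  GInvariant S W ∧ Hereditary S W ∧ Saturated S W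

/-- Condition (Con): every vertex is reachable from a `G`-cycle with an entrance. -/
def CondCon (S : SSA) : Prop :=
  ∀ v : S.V, ∃ p : Path S, p.rng = v ∧
    ∃ (g : S.G) (c : Path S), GCycle S g c ∧ c.hasEntrance ∧ p.src ∈ c.baseVerts

/-- The underlying set (with zero `none`) of the inverse semigroup `S(G,E)`. -/
abbrev SGE (S : SSA) : Type := Option (Path S × S.G × Path S)

/-- Well-formedness of a triple `(α, g, β)` : `r g = s α` and `s g = s β`. -/
def SGE.wf (S : SSA) : SGE S → Prop
  | none => True
  | some (α, g, β) => S.gr g = α.src ∧ S.gs g = β.src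

/-- The idempotent `f_α = (α, s α, α)`. -/
def fIdem (S : SSA) (α : Path S) : SGE S := some (α, S.one α.src, α)

/-- The involution `(α,g,β)* = (β,g⁻¹,α)` on `S(G,E)`. -/
def sgeStar (S : SSA) : SGE S → SGE S
  | none => none
  | some (α, g, β) => some (β, S.inv g, α)

/-- The multiplication of the inverse semigroup `S(G,E)`. -/
def sgeMul (S : SSA) : SGE S → SGE S → SGE S
  | none, _ => none
  | some _, none => none
  | some (α, g, β), some (γ, h, δ) =>
    if SGE.wf S (some (α, g, β)) ∧ SGE.wf S (some (γ, h, δ)) then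
      if h1 : ∃ β' : Path S, β.src = Path.rng β' ∧ γ = β.comp β' then
        some (α.comp (pact S g h1.choose), S.mul (pres S g h1.choose) h, δ)
      else if h2 : ∃ γ' : Path S, γ.src = Path.rng γ' ∧ β = γ.comp γ' then
        some (α, S.mul g (S.inv (pres S (S.inv h) h2.choose)),
          δ.comp (pact S (S.inv h) h2.choose))
      else none
    else none

/-- Membership in the subsemigroup `S₀(G,E)` (with zero): triples with `|α| = |β|`. -/
def domS0 (S : SSA) (x : SGE S) : Prop :=
  SGE.wf S x ∧ (x = none ∨ ∃ (α : Path S) (g : S.G) (β : Path S),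
    x = some (α, g, β) ∧ α.length = β.length)

/-- Membership in the subsemigroup `S₀₀(G,E)` (with zero): triples `(g·β, g|_β, β)`. -/
def domS00 (S : SSA) (x : SGE S) : Prop :=
  SGE.wf S x ∧ (x = none ∨ ∃ (g : S.G) (β : Path S),
    S.gs g = β.rng ∧ x = some (pact S g β, pres S g β, β))

/-- `S(G,E)` as raw inverse-semigroup data. -/
def sgeSem (S : SSA) : RawSem (SGE S) := ⟨sgeMul S, sgeStar S, none, SGE.wf S⟩

/-- `S₀(G,E)` as raw inverse-semigroup data. -/
def sgeSem0 (S : SSA) : RawSem (SGE S) := ⟨sgeMul S, sgeStar S, none, domS0 S⟩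

/-- `S₀₀(G,E)` as raw inverse-semigroup data. -/
def sgeSem00 (S : SSA) : RawSem (SGE S) := ⟨sgeMul S, sgeStar S, none, domS00 S⟩

/-- The inductive extension of `σ_⋈` to finite paths:
`σ_⋈(h, s h) = 1`, `σ_⋈(h, e μ) = σ_⋈(h, e) σ_⋈(h|_e, μ)`. -/
def twAux (S : SSA) (σB : S.G → S.E → ℂ) : ∀ {a b : S.V}, S.G → S.Pth a b → ℂ
  | _, _, _, .nil _ => 1
  | _, _, g, .cons e p => σB g e * twAux S σB (S.res g e) p

/-- The extension `σ_⋈ : G * E^* → 𝕋` of a twist to finite paths. -/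
def twP (S : SSA) (σB : S.G → S.E → ℂ) (g : S.G) (p : Path S) : ℂ := twAux S σB g p.pth

/-- The `2`-cocycle `ω_σ` on `S(G,E)` induced by a twist `σ` of `(G,E)`. -/
def omg (S : SSA) (T : Twist S) : SGE S → SGE S → ℂ := fun x y =>
  match x, y with
  | some (_, g, β), some (γ, h, _) =>
    if h1 : ∃ β' : Path S, β.src = Path.rng β' ∧ γ = β.comp β' then
      twP S T.σB g h1.choose * T.σG (pres S g h1.choose) h
    else if h2 : ∃ γ' : Path S, γ.src = Path.rng γ' ∧ β = γ.comp γ' then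
      T.σG g (S.inv (pres S (S.inv h) h2.choose)) * twP S T.σB h (pact S (S.inv h) h2.choose)
    else 1
  | _, _ => 1


end SSA

namespace SSA

variable {S : SSA}

theorem aux_ext {a b : S.V} (p : S.Pth a b) : ∀ {a' b' : S.V} (q : S.Pth a' b'), a = a' →
    p.toList = q.toList → Path.mk a b p = Path.mk a' b' q := by
  induction p with
  | nil v =>
    intro a' b' q h ht
    cases q with
    | nil w => subst h; rfl
    | cons e q => simp [Pth.toList] at ht
  | cons e p ih =>
    intro a' b' q h ht
    cases q with
    | nil w => simp [Pth.toList] at ht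
    | cons e' q =>
      simp only [Pth.toList, List.cons.injEq] at ht
      obtain ⟨rfl, ht⟩ := ht
      have := ih q rfl ht
      simp only [Path.mk.injEq, true_and] at this
      obtain ⟨rfl, h2⟩ := this
      have h2 := eq_of_heq h2
      subst h2
      rfl

theorem path_ext {p q : Path S} (h : p.rng = q.rng) (ht : p.toList = q.toList) : p = q := by
  cases p; cases q
  exact aux_ext _ _ h ht

theorem pth_toList_comp {a b c : S.V} (p : S.Pth a b) (q : S.Pth b c) :
    (p.comp q).toList = p.toList ++ q.toList := by
  induction p with
  | nil v => rfl
  | cons e p ih => simp [Pth.comp, Pth.toList, ih]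

theorem pth_length {a b : S.V} (p : S.Pth a b) : p.length = p.toList.length := by
  induction p with
  | nil v => rfl
  | cons e p ih => simp [Pth.length, Pth.toList, ih]

theorem length_eq (p : Path S) : p.length = p.toList.length := pth_length _

theorem comp_mk {a b c : S.V} (p : S.Pth a b) (q : S.Pth b c) :
    Path.comp ⟨a, b, p⟩ ⟨b, c, q⟩ = ⟨a, c, p.comp q⟩ := by
  unfold Path.comp
  rw [dif_pos rfl]
  rfl

theorem comp_rng (p q : Path S) : (p.comp q).rng = p.rng := by
  unfold Path.comp; split <;> rfl

theorem comp_src {p q : Path S} (h : p.src = q.rng) : (p.comp q).src = q.src := by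
  unfold Path.comp; rw [dif_pos h]

theorem comp_toList {p q : Path S} (h : p.src = q.rng) :
    (p.comp q).toList = p.toList ++ q.toList := by
  obtain ⟨a, b, p⟩ := p
  obtain ⟨c, d, q⟩ := q
  dsimp at h
  subst h
  rw [comp_mk]
  exact pth_toList_comp p q

theorem comp_assoc {p q r : Path S} (h : p.src = q.rng) (h' : q.src = r.rng) :
    (p.comp q).comp r = p.comp (q.comp r) := by
  apply path_ext
  · simp [comp_rng]
  · rw [comp_toList (by rw [comp_src h, h']), comp_toList h,
      comp_toList (by rw [comp_rng, h]), comp_toList h', List.append_assoc]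

theorem comp_cancel {p q r : Path S} (h : p.src = q.rng) (h' : p.src = r.rng)
    (he : p.comp q = p.comp r) : q = r := by
  apply path_ext
  · rw [← h, h']
  · have := congrArg Path.toList he
    rw [comp_toList h, comp_toList h'] at this
    exact List.append_cancel_left this

theorem comp_inj {p p' q q' : Path S} (h : p.src = q.rng) (h' : p'.src = q'.rng)
    (hl : p.length = p'.length) (he : p.comp q = p'.comp q') : p = p' ∧ q = q' := by
  have ht := congrArg Path.toList he
  rw [comp_toList h, comp_toList h'] at ht
  rw [length_eq, length_eq] at hl
  have := (List.append_inj ht hl).1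
  have hr := congrArg Path.rng he
  rw [comp_rng, comp_rng] at hr
  obtain rfl := path_ext hr this
  exact ⟨rfl, comp_cancel h h' he⟩

theorem vert_toList (v : S.V) : (Path.vert S v).toList = [] := rfl
theorem vert_rng (v : S.V) : (Path.vert S v).rng = v := rfl
theorem vert_src (v : S.V) : (Path.vert S v).src = v := rfl

theorem comp_vert {p : Path S} {v : S.V} (h : p.src = v) : p.comp (Path.vert S v) = p := by
  apply path_ext
  · simp [comp_rng]
  · rw [comp_toList (by exact h), vert_toList, List.append_nil]

theorem vert_comp {p : Path S} {v : S.V} (h : v = p.rng) : (Path.vert S v).comp p = p := by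
  apply path_ext
  · simp [comp_rng, h, vert_rng]
  · rw [comp_toList (by exact h), vert_toList, List.nil_append]

theorem eq_vert {p : Path S} (h : p.length = 0) : p = Path.vert S p.rng := by
  refine path_ext (q := Path.vert S p.rng) rfl ?_
  rw [length_eq] at h
  rw [List.eq_nil_of_length_eq_zero h]; rfl

theorem comp_length {p q : Path S} (h : p.src = q.rng) :
    (p.comp q).length = p.length + q.length := by
  simp [length_eq, comp_toList h]

theorem comp_eq_self {p q : Path S} (h : p.src = q.rng) (he : p.comp q = p) :
    q = Path.vert S p.src := by
  have := comp_length h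
  rw [he] at this
  rw [h]; exact eq_vert (by omega)

theorem path_ind {P : Path S → Prop} (hv : ∀ v, P (Path.vert S v))
    (hc : ∀ e q, S.es e = Path.rng q → P q → P ((Path.ofEdge S e).comp q)) (p : Path S) : P p := by
  obtain ⟨a, b, p⟩ := p
  induction p with
  | nil v => exact hv v
  | cons e p ih =>
    have := hc e _ rfl ih
    rw [Path.ofEdge, comp_mk] at this
    exact this

theorem pact_vert (g : S.G) (v : S.V) : pact S g (Path.vert S v) = Path.vert S (S.gr g) := rfl
theorem pres_vert (g : S.G) (v : S.V) : pres S g (Path.vert S v) = g := rfl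

theorem pact_cons (g : S.G) (e : S.E) (q : Path S) (h : S.es e = q.rng) :
    pact S g ((Path.ofEdge S e).comp q) =
      (Path.ofEdge S (S.act g e)).comp (pact S (S.res g e) q) := by
  obtain ⟨a, b, q⟩ := q
  dsimp at h
  subst h
  rw [Path.ofEdge, comp_mk]
  rfl

theorem pres_cons (g : S.G) (e : S.E) (q : Path S) (h : S.es e = q.rng) :
    pres S g ((Path.ofEdge S e).comp q) = pres S (S.res g e) q := by
  obtain ⟨a, b, q⟩ := q
  dsimp at h
  subst h
  rw [Path.ofEdge, comp_mk]
  rfl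

theorem pact_facts (p : Path S) : ∀ g : S.G, S.gs g = p.rng →
    (pact S g p).rng = S.gr g ∧ (pact S g p).src = S.gr (pres S g p) ∧
    S.gs (pres S g p) = p.src ∧ (pact S g p).length = p.length := by
  induction p using path_ind with
  | hv v => intro g h; exact ⟨rfl, rfl, h, rfl⟩
  | hc e q h ih =>
    intro g hg
    rw [comp_rng] at hg
    obtain ⟨h1, h2, h3, h4⟩ := ih (S.res g e) (by rw [S.gs_res g e hg, h])
    have hc : (Path.ofEdge S (S.act g e)).src = (pact S (S.res g e) q).rng := by
      rw [h1, S.gr_res g e hg]; rfl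
    rw [pact_cons _ _ _ h, pres_cons _ _ _ h, comp_rng, comp_src hc, comp_length hc,
      comp_src (p := Path.ofEdge S e) h, comp_length (p := Path.ofEdge S e) h]
    exact ⟨S.er_act g e hg, h2, h3, by rw [h4]; rfl⟩

theorem pact_rng {g : S.G} {p : Path S} (h : S.gs g = p.rng) : (pact S g p).rng = S.gr g :=
  (pact_facts p g h).1
theorem pact_src {g : S.G} {p : Path S} (h : S.gs g = p.rng) :
    (pact S g p).src = S.gr (pres S g p) := (pact_facts p g h).2.1
theorem gs_pres {g : S.G} {p : Path S} (h : S.gs g = p.rng) : S.gs (pres S g p) = p.src :=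
  (pact_facts p g h).2.2.1
theorem pact_length {g : S.G} {p : Path S} (h : S.gs g = p.rng) :
    (pact S g p).length = p.length := (pact_facts p g h).2.2.2

theorem pact_comp_facts (p q : Path S) (hpq : p.src = q.rng) : ∀ g : S.G, S.gs g = p.rng →
    pact S g (p.comp q) = (pact S g p).comp (pact S (pres S g p) q) ∧
    pres S g (p.comp q) = pres S (pres S g p) q := by
  induction p using path_ind with
  | hv v =>
    intro g hg
    rw [vert_comp (v := v) hpq, pact_vert, pres_vert, vert_comp]
    · exact ⟨rfl, rfl⟩
    · rw [pact_rng]; rw [hg, ← hpq]; rfl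
  | hc e r h ih =>
    intro g hg
    rw [comp_rng] at hg
    rw [comp_src (p := Path.ofEdge S e) h] at hpq
    have hg' : S.gs (S.res g e) = r.rng := by rw [S.gs_res g e hg, h]
    obtain ⟨h1, h2⟩ := ih hpq _ hg'
    have hrq : S.es e = (r.comp q).rng := by rw [comp_rng, h]
    rw [comp_assoc h hpq, pact_cons _ _ _ hrq, h1,
      pres_cons _ _ _ hrq, h2, pact_cons _ _ _ h, pres_cons _ _ _ h]
    refine ⟨?_, rfl⟩
    rw [comp_assoc]
    · rw [pact_rng hg', S.gr_res g e hg]; rfl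
    · rw [pact_src hg', pact_rng]; rw [gs_pres hg', hpq]

theorem pact_comp {g : S.G} {p q : Path S} (hpq : p.src = q.rng) (h : S.gs g = p.rng) :
    pact S g (p.comp q) = (pact S g p).comp (pact S (pres S g p) q) :=
  (pact_comp_facts p q hpq g h).1
theorem pres_comp {g : S.G} {p q : Path S} (hpq : p.src = q.rng) (h : S.gs g = p.rng) :
    pres S g (p.comp q) = pres S (pres S g p) q :=
  (pact_comp_facts p q hpq g h).2

theorem pact_mul_facts (p : Path S) : ∀ g h : S.G, S.gs g = S.gr h → S.gs h = p.rng →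
    pact S (S.mul g h) p = pact S g (pact S h p) ∧
    pres S (S.mul g h) p = S.mul (pres S g (pact S h p)) (pres S h p) := by
  induction p using path_ind with
  | hv v =>
    intro g h hgh hh
    simp only [pact_vert, pres_vert]
    rw [S.gr_mul g h hgh]; exact ⟨rfl, trivial⟩
  | hc e r her ih =>
    intro g h hgh hh
    rw [comp_rng] at hh
    have hh' : S.gs (S.res h e) = r.rng := by rw [S.gs_res h e hh, her]
    have hge : S.gs g = S.er (S.act h e) := by rw [hgh, S.er_act h e hh]
    have hc : S.es (S.act h e) = (pact S (S.res h e) r).rng := by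
      rw [pact_rng hh', S.gr_res h e hh]
    obtain ⟨h1, h2⟩ := ih (S.res g (S.act h e)) (S.res h e)
      (by rw [S.gs_res _ _ hge, S.gr_res _ _ hh]) hh'
    rw [pact_cons _ _ _ her, pact_cons _ _ _ her, pres_cons _ _ _ her, pres_cons _ _ _ her,
      pact_cons _ _ _ hc, pres_cons _ _ _ hc, S.act_mul g h e hgh hh, S.res_mul g h e hgh hh,
      h1, h2]
    exact ⟨rfl, rfl⟩

theorem pact_mul {g h : S.G} {p : Path S} (hgh : S.gs g = S.gr h) (hh : S.gs h = p.rng) :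
    pact S (S.mul g h) p = pact S g (pact S h p) := (pact_mul_facts p g h hgh hh).1
theorem pres_mul {g h : S.G} {p : Path S} (hgh : S.gs g = S.gr h) (hh : S.gs h = p.rng) :
    pres S (S.mul g h) p = S.mul (pres S g (pact S h p)) (pres S h p) :=
  (pact_mul_facts p g h hgh hh).2

theorem idem_one {g : S.G} (h : S.gs g = S.gr g) (he : S.mul g g = g) : g = S.one (S.gs g) := by
  have := congrArg (S.mul (S.inv g)) he
  rw [← S.mul_assoc' _ _ _ (S.gs_inv g) h, S.inv_mul', h, S.one_mul'] at this
  rw [h]; exact this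

theorem res_one (e : S.E) : S.res (S.one (S.er e)) e = S.one (S.es e) := by
  have h1 : S.gs (S.one (S.er e)) = S.er e := S.gs_one _
  have h0 : S.gs (S.one (S.er e)) = S.gr (S.one (S.er e)) := by rw [S.gs_one, S.gr_one]
  have h2 := S.res_mul _ _ e h0 h1
  have h3 : S.mul (S.one (S.er e)) (S.one (S.er e)) = S.one (S.er e) := by
    have := S.mul_one' (S.one (S.er e))
    rwa [S.gs_one] at this
  rw [h3, S.act_one] at h2
  have := idem_one (by rw [S.gs_res _ _ h1, S.gr_res _ _ h1, S.act_one]) h2.symm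
  rwa [S.gs_res _ _ h1] at this

theorem one_facts (p : Path S) : ∀ v, v = p.rng → pact S (S.one v) p = p ∧
    pres S (S.one v) p = S.one p.src := by
  induction p using path_ind with
  | hv v => rintro _ rfl; rw [pact_vert, pres_vert, S.gr_one]; exact ⟨rfl, rfl⟩
  | hc e r h ih =>
    rintro v hv
    rw [comp_rng] at hv
    replace hv : v = S.er e := hv
    subst hv
    rw [pact_cons _ _ _ h, pres_cons _ _ _ h, res_one, S.act_one, (ih _ h).1, (ih _ h).2,
      comp_src (p := Path.ofEdge S e) h]
    exact ⟨rfl, rfl⟩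

theorem pact_one {p : Path S} {v : S.V} (h : v = p.rng) : pact S (S.one v) p = p :=
  (one_facts p v h).1
theorem pres_one {p : Path S} {v : S.V} (h : v = p.rng) : pres S (S.one v) p = S.one p.src :=
  (one_facts p v h).2

theorem inv_unique {g h : S.G} (h1 : S.gs g = S.gr h) (he : S.mul g h = S.one (S.gs h)) :
    g = S.inv h := by
  have := congrArg (fun x => S.mul x (S.inv h)) he
  rw [S.mul_assoc' _ _ _ h1 (by rw [S.gr_inv]), S.mul_inv', ← h1, S.mul_one', ← S.gr_inv,
    S.one_mul'] at this
  exact this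

theorem inv_inv' (g : S.G) : S.inv (S.inv g) = g := by
  symm
  apply inv_unique
  · rw [S.gr_inv]
  · rw [S.mul_inv', S.gs_inv]

theorem inv_one (v : S.V) : S.inv (S.one v) = S.one v := by
  symm
  apply inv_unique
  · rw [S.gs_one, S.gr_one]
  · have := S.mul_one' (S.one v)
    rwa [S.gs_one] at this ⊢

theorem mul_one'' {g : S.G} {v : S.V} (h : v = S.gs g) : S.mul g (S.one v) = g := by
  rw [h, S.mul_one']

theorem one_mul'' {g : S.G} {v : S.V} (h : v = S.gr g) : S.mul (S.one v) g = g := by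
  rw [h, S.one_mul']

/-- First multiplication rule. -/
theorem mul_rule1 {α β γ δ β' : Path S} {g h : S.G} (h1 : S.gr g = α.src) (h2 : S.gs g = β.src)
    (h3 : S.gr h = γ.src) (h4 : S.gs h = δ.src) (hb : β.src = β'.rng) (hc : γ = β.comp β') :
    sgeMul S (some (α, g, β)) (some (γ, h, δ)) =
      some (α.comp (pact S g β'), S.mul (pres S g β') h, δ) := by
  have hex : ∃ β' : Path S, β.src = Path.rng β' ∧ γ = β.comp β' := ⟨β', hb, hc⟩
  have hch : hex.choose = β' :=
    comp_cancel hex.choose_spec.1 hb (hex.choose_spec.2.symm.trans hc)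
  simp only [sgeMul]
  rw [if_pos ⟨⟨h1, h2⟩, ⟨h3, h4⟩⟩, dif_pos hex, hch]

theorem pos_prefix_absurd {β γ β' γ' : Path S} (hb : β.src = β'.rng) (hc : γ = β.comp β')
    (hb' : γ.src = γ'.rng) (hc' : β = γ.comp γ') : β' = Path.vert S β.src ∧
      γ' = Path.vert S β.src ∧ β = γ := by
  have e1 := congrArg Path.length hc
  have e2 := congrArg Path.length hc'
  rw [comp_length hb] at e1
  rw [comp_length hb'] at e2
  have hv : β' = Path.vert S β.src := by rw [hb]; exact eq_vert (by omega)
  have : γ = β := by rw [hc, hv, comp_vert rfl]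
  subst this
  exact ⟨hv, by rw [hb']; exact eq_vert (by omega), rfl⟩

/-- Second multiplication rule. -/
theorem mul_rule2 {α β γ δ γ' : Path S} {g h : S.G} (h1 : S.gr g = α.src) (h2 : S.gs g = β.src)
    (h3 : S.gr h = γ.src) (h4 : S.gs h = δ.src) (hb : γ.src = γ'.rng) (hc : β = γ.comp γ') :
    sgeMul S (some (α, g, β)) (some (γ, h, δ)) =
      some (α, S.mul g (S.inv (pres S (S.inv h) γ')), δ.comp (pact S (S.inv h) γ')) := by
  by_cases hex1 : ∃ β' : Path S, β.src = Path.rng β' ∧ γ = β.comp β'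
  · obtain ⟨β', hb1, hc1⟩ := hex1
    obtain ⟨e1, e2, e3⟩ := pos_prefix_absurd hb1 hc1 hb hc
    rw [mul_rule1 h1 h2 h3 h4 hb1 hc1, e1, e2]
    simp only [pact_vert, pres_vert]
    rw [comp_vert h1.symm, inv_inv', S.gr_inv, comp_vert h4.symm]
  · have hex : ∃ γ' : Path S, γ.src = Path.rng γ' ∧ β = γ.comp γ' := ⟨γ', hb, hc⟩
    have hch : hex.choose = γ' :=
      comp_cancel hex.choose_spec.1 hb (hex.choose_spec.2.symm.trans hc)
    simp only [sgeMul]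
    rw [if_pos ⟨⟨h1, h2⟩, ⟨h3, h4⟩⟩, dif_neg hex1, dif_pos hex, hch]

theorem mul_rule3 {α β γ δ : Path S} {g h : S.G}
    (hn1 : ¬ IsPrefix S β γ) (hn2 : ¬ IsPrefix S γ β) :
    sgeMul S (some (α, g, β)) (some (γ, h, δ)) = none := by
  simp only [sgeMul]
  split_ifs with h1 h2 h3
  · exact absurd h2 hn1
  · exact absurd h3 hn2
  · rfl
  · rfl

/-- Product of `(α,g,β)` with an idempotent below. -/
theorem mul_fIdem1 {α β μ : Path S} {g : S.G} (h1 : S.gr g = α.src) (h2 : S.gs g = β.src)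
    (hb : β.src = μ.rng) : sgeMul S (some (α, g, β)) (fIdem S (β.comp μ)) =
      some (α.comp (pact S g μ), pres S g μ, β.comp μ) := by
  unfold fIdem
  rw [mul_rule1 h1 h2 (S.gr_one _) (S.gs_one _) hb rfl, mul_one'']
  rw [gs_pres (by rw [h2, hb]), comp_src hb]

theorem mul_fIdem2 {α γ μ : Path S} {g : S.G} (h1 : S.gr g = α.src) (h2 : S.gs g = μ.src)
    (hb : γ.src = μ.rng) : sgeMul S (some (α, g, γ.comp μ)) (fIdem S γ) =
      some (α, g, γ.comp μ) := by
  unfold fIdem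
  rw [mul_rule2 h1 (by rw [h2, comp_src hb]) (S.gr_one _) (S.gs_one _) hb rfl, inv_one,
    pres_one hb, pact_one hb, inv_one, mul_one'' h2.symm]

theorem star_mul_self {α β : Path S} {g : S.G} (h1 : S.gr g = α.src) (h2 : S.gs g = β.src) :
    sgeMul S (sgeStar S (some (α, g, β))) (some (α, g, β)) = fIdem S β := by
  unfold sgeStar fIdem
  rw [mul_rule1 (β' := Path.vert S α.src) (by rw [S.gr_inv, h2]) (by rw [S.gs_inv, h1]) h1 h2 rfl
    (comp_vert rfl).symm, pact_vert, pres_vert, S.gr_inv, comp_vert h2.symm, S.inv_mul', h2]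

theorem conj1 {α β μ : Path S} {g : S.G} (h1 : S.gr g = α.src) (h2 : S.gs g = β.src)
    (hb : β.src = μ.rng) :
    sgeMul S (sgeMul S (some (α, g, β)) (fIdem S (β.comp μ))) (sgeStar S (some (α, g, β))) =
      fIdem S (α.comp (pact S g μ)) := by
  have hg : S.gs g = μ.rng := by rw [h2, hb]
  have hc : α.src = (pact S g μ).rng := by rw [pact_rng hg, h1]
  rw [mul_fIdem1 h1 h2 hb]
  unfold sgeStar
  rw [mul_rule2 (γ' := μ) (by rw [comp_src hc, pact_src hg]) (by rw [comp_src hb, gs_pres hg])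
    (by rw [S.gr_inv, h2]) (by rw [S.gs_inv, h1]) hb rfl, inv_inv', S.mul_inv']
  unfold fIdem
  rw [comp_src hc, pact_src hg]

theorem conj2 {α γ μ : Path S} {g : S.G} (h1 : S.gr g = α.src) (h2 : S.gs g = μ.src)
    (hb : γ.src = μ.rng) :
    sgeMul S (sgeMul S (some (α, g, γ.comp μ)) (fIdem S γ))
      (sgeStar S (some (α, g, γ.comp μ))) = fIdem S α := by
  have h2' : S.gs g = (γ.comp μ).src := by rw [comp_src hb, h2]
  have := conj1 (μ := Path.vert S (γ.comp μ).src) h1 h2' rfl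
  rw [comp_vert rfl, pact_vert, comp_vert h1.symm] at this
  have h3 := mul_fIdem1 (μ := Path.vert S (γ.comp μ).src) h1 h2' rfl
  rw [comp_vert rfl, pact_vert, comp_vert h1.symm, pres_vert] at h3
  rw [mul_fIdem2 h1 h2 hb, ← this, h3]

theorem conj3 {α β γ : Path S} {g : S.G} (hn1 : ¬ IsPrefix S β γ) (hn2 : ¬ IsPrefix S γ β) :
    sgeMul S (sgeMul S (some (α, g, β)) (fIdem S γ)) (sgeStar S (some (α, g, β))) = none := by
  unfold fIdem
  rw [mul_rule3 hn1 hn2]; rfl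

theorem fIdem_inj {α β : Path S} (h : fIdem S α = fIdem S β) : α = β := by
  simp only [fIdem, Option.some.injEq, Prod.mk.injEq] at h
  exact h.1

theorem fIdem_wf (α : Path S) : SGE.wf S (fIdem S α) := ⟨S.gr_one _, S.gs_one _⟩

theorem fIdem_mul_self (α : Path S) : sgeMul S (fIdem S α) (fIdem S α) = fIdem S α := by
  have := mul_fIdem1 (S.gr_one α.src) (S.gs_one α.src) (μ := Path.vert S α.src) rfl
  rw [comp_vert rfl, pact_vert, pres_vert, S.gr_one, comp_vert rfl] at this
  exact this

theorem fIdem_mul_ne {α β : Path S} (h : IsPrefix S α β ∨ IsPrefix S β α) :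
    sgeMul S (fIdem S α) (fIdem S β) ≠ none := by
  rcases h with ⟨r, h1, rfl⟩ | ⟨r, h1, rfl⟩
  · unfold fIdem
    rw [mul_rule1 (S.gr_one _) (S.gs_one _) (S.gr_one _) (S.gs_one _) h1 rfl]
    simp
  · unfold fIdem
    rw [mul_rule2 (S.gr_one _) (S.gs_one _) (S.gr_one _) (S.gs_one _) h1 rfl]
    simp

theorem fIdem_mul_ne_iff {α β : Path S} :
    sgeMul S (fIdem S α) (fIdem S β) ≠ none ↔ IsPrefix S α β ∨ IsPrefix S β α := by
  refine ⟨fun h => ?_, fIdem_mul_ne⟩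
  by_contra hn
  rw [not_or] at hn
  exact h (mul_rule3 hn.1 hn.2)

theorem idem_eq {x : SGE S} (hwf : SGE.wf S x) (hm : sgeMul S x x = x) (hn : x ≠ none) :
    ∃ α, x = fIdem S α := by
  obtain _ | ⟨α, g, β⟩ := x
  · exact absurd rfl hn
  obtain ⟨h1, h2⟩ := hwf
  have key : α = β := by
    by_cases hp : IsPrefix S β α
    · obtain ⟨r, hr, hc⟩ := hp
      rw [mul_rule1 h1 h2 h1 h2 hr hc] at hm
      simp only [Option.some.injEq, Prod.mk.injEq] at hm
      have hg : S.gs g = r.rng := by rw [h2, hr]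
      have hv := congrArg Path.length hm.1
      rw [comp_length (by rw [pact_rng hg, h1]), pact_length hg] at hv
      have : r = Path.vert S β.src := by rw [hr]; exact eq_vert (by omega)
      rw [hc, this, comp_vert rfl]
    · by_cases hp' : IsPrefix S α β
      · obtain ⟨r, hr, hc⟩ := hp'
        rw [mul_rule2 h1 h2 h1 h2 hr hc] at hm
        simp only [Option.some.injEq, Prod.mk.injEq] at hm
        have hg : S.gs (S.inv g) = r.rng := by rw [S.gs_inv, h1, hr]
        have hv := congrArg Path.length hm.2.2
        rw [comp_length (by rw [pact_rng hg, S.gr_inv, h2]), pact_length hg] at hv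
        have : r = Path.vert S α.src := by rw [hr]; exact eq_vert (by omega)
        rw [hc, this, comp_vert rfl]
      · rw [mul_rule3 hp hp'] at hm
        simp at hm
  subst key
  rw [mul_rule1 h1 h2 h1 h2 (β' := Path.vert S α.src) rfl (comp_vert rfl).symm, pres_vert] at hm
  simp only [Option.some.injEq, Prod.mk.injEq] at hm
  refine ⟨α, ?_⟩
  unfold fIdem
  rw [← h2, ← idem_one (by rw [h1, h2]) hm.2.1]

/-- Characterization of the natural partial order. -/
theorem le_iff {R : RawSem (SGE S)} (hm : R.mul = sgeMul S) (hs : R.star = sgeStar S)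
    {α β α' β' : Path S} {g g' : S.G}
    (h1 : S.gr g = α.src) (h2 : S.gs g = β.src) (h1' : S.gr g' = α'.src) (h2' : S.gs g' = β'.src) :
    R.le (some (α', g', β')) (some (α, g, β)) ↔
      ∃ μ : Path S, β.src = μ.rng ∧ β' = β.comp μ ∧ α' = α.comp (pact S g μ) ∧
        g' = pres S g μ := by
  unfold RawSem.le
  rw [hm, hs, star_mul_self h1' h2']
  constructor
  · intro h
    by_cases hp : IsPrefix S β β'
    · obtain ⟨μ, hb, rfl⟩ := hp
      rw [mul_fIdem1 h1 h2 hb] at h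
      simp only [Option.some.injEq, Prod.mk.injEq] at h
      exact ⟨μ, hb, rfl, h.1, h.2.1⟩
    · by_cases hp' : IsPrefix S β' β
      · obtain ⟨μ, hb, rfl⟩ := hp'
        rw [comp_src hb] at h2
        rw [mul_fIdem2 h1 h2 hb] at h
        simp only [Option.some.injEq, Prod.mk.injEq] at h
        refine ⟨Path.vert S (β'.comp μ).src, rfl, ?_, ?_, ?_⟩
        · rw [comp_vert rfl]; exact h.2.2
        · rw [pact_vert, comp_vert h1.symm]; exact h.1
        · exact h.2.1
      · unfold fIdem at h
        rw [mul_rule3 hp hp'] at h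
        simp at h
  · rintro ⟨μ, hb, rfl, rfl, rfl⟩
    rw [mul_fIdem1 h1 h2 hb]

theorem fIdem_le_iff {R : RawSem (SGE S)} (hm : R.mul = sgeMul S) (hs : R.star = sgeStar S)
    {α β : Path S} : R.le (fIdem S α) (fIdem S β) ↔ IsPrefix S β α := by
  unfold fIdem
  rw [le_iff hm hs (S.gr_one _) (S.gs_one _) (S.gr_one _) (S.gs_one _)]
  constructor
  · rintro ⟨μ, h, e, _⟩; exact ⟨μ, h, e⟩
  · rintro ⟨μ, h, rfl⟩
    exact ⟨μ, h, rfl, by rw [pact_one h], by rw [pres_one h, comp_src h]⟩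

theorem nz_iff (α : SGE S) : (sgeSem S).NzIdem α ↔ ∃ p, α = fIdem S p := by
  constructor
  · rintro ⟨h1, h2, h3⟩; exact idem_eq h1 h2 h3
  · rintro ⟨p, rfl⟩; exact ⟨fIdem_wf p, fIdem_mul_self p, by simp [fIdem, sgeSem]⟩

theorem nz0_iff (α : SGE S) : (sgeSem0 S).NzIdem α ↔ ∃ p, α = fIdem S p := by
  constructor
  · rintro ⟨h1, h2, h3⟩; exact idem_eq h1.1 h2 h3
  · rintro ⟨p, rfl⟩
    exact ⟨⟨fIdem_wf p, Or.inr ⟨_, _, _, rfl, rfl⟩⟩, fIdem_mul_self p, by simp [fIdem, sgeSem0]⟩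

theorem nz00_iff (α : SGE S) : (sgeSem00 S).NzIdem α ↔ ∃ p, α = fIdem S p := by
  constructor
  · rintro ⟨h1, h2, h3⟩; exact idem_eq h1.1 h2 h3
  · rintro ⟨p, rfl⟩
    refine ⟨⟨fIdem_wf p, Or.inr ⟨S.one p.rng, p, S.gs_one _, ?_⟩⟩, fIdem_mul_self p,
      by simp [fIdem, sgeSem00]⟩
    rw [pact_one rfl, pres_one rfl]; rfl

theorem conj_ne {α β γ : Path S} {g : S.G}
    (h : sgeMul S (sgeMul S (some (α, g, β)) (fIdem S γ)) (sgeStar S (some (α, g, β))) ≠ none) :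
    IsPrefix S β γ ∨ IsPrefix S γ β := by
  by_contra hn
  rw [not_or] at hn
  exact h (conj3 hn.1 hn.2)

theorem fIdem_ne (α : Path S) : fIdem S α ≠ none := by simp [fIdem]

theorem conj_self {α β : Path S} {g : S.G} (h1 : S.gr g = α.src) (h2 : S.gs g = β.src) :
    sgeMul S (sgeMul S (some (α, g, β)) (fIdem S β)) (sgeStar S (some (α, g, β))) =
      fIdem S α := by
  have := conj1 (μ := Path.vert S β.src) h1 h2 rfl
  rwa [comp_vert rfl, pact_vert, comp_vert h1.symm] at this

theorem conj_eq_facts_aux {α β γ δ' δ : Path S} {g h : S.G}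
    (h1 : S.gr g = α.src) (h2 : S.gs g = β.src) (h3 : S.gr h = γ.src) (h4 : S.gs h = δ.src)
    (H : ∀ p : Path S, sgeMul S (sgeMul S (some (α, g, β)) (fIdem S p))
        (sgeStar S (some (α, g, β))) =
      sgeMul S (sgeMul S (some (γ, h, δ)) (fIdem S p)) (sgeStar S (some (γ, h, δ))))
    (hd : δ.src = δ'.rng) (hc : β = δ.comp δ') : α = γ ∧ β = δ := by
  have hh : S.gs h = δ'.rng := by rw [h4, hd]
  have hcc : γ.src = (pact S h δ').rng := by rw [pact_rng hh, h3]
  have e1 := H β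
  rw [conj_self h1 h2] at e1
  have e2 := H δ
  rw [conj_self h3 h4] at e2
  subst hc
  rw [conj1 h3 h4 hd] at e1
  rw [conj2 h1 (by rw [h2, comp_src hd]) hd] at e2
  have e1 := fIdem_inj e1
  have e2 := fIdem_inj e2
  refine ⟨e2, ?_⟩
  have hl := congrArg Path.length e1
  rw [comp_length hcc, pact_length hh, e2] at hl
  have : δ' = Path.vert S δ.src := by rw [hd]; exact eq_vert (by omega)
  rw [this, comp_vert rfl]

theorem conj_eq_facts {α β γ δ : Path S} {g h : S.G}
    (h1 : S.gr g = α.src) (h2 : S.gs g = β.src) (h3 : S.gr h = γ.src) (h4 : S.gs h = δ.src)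
    (H : ∀ p : Path S, sgeMul S (sgeMul S (some (α, g, β)) (fIdem S p))
        (sgeStar S (some (α, g, β))) =
      sgeMul S (sgeMul S (some (γ, h, δ)) (fIdem S p)) (sgeStar S (some (γ, h, δ)))) :
    α = γ ∧ β = δ ∧ FixesAll S (S.mul (S.inv h) g) := by
  have key : α = γ ∧ β = δ := by
    have e1 := H β
    rw [conj_self h1 h2] at e1
    rcases conj_ne (e1 ▸ fIdem_ne α) with ⟨r, hr, hc⟩ | ⟨r, hr, hc⟩
    · exact conj_eq_facts_aux h1 h2 h3 h4 H hr hc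
    · have := conj_eq_facts_aux h3 h4 h1 h2 (fun p => (H p).symm) hr hc
      exact ⟨this.1.symm, this.2.symm⟩
  obtain ⟨rfl, rfl⟩ := key
  refine ⟨rfl, rfl, fun p hp => ?_⟩
  have hig : S.gs (S.inv h) = S.gr g := by rw [S.gs_inv, h3, h1]
  rw [S.gs_mul _ _ hig] at hp
  have hb : β.src = p.rng := by rw [hp, h2]
  have e := H (β.comp p)
  rw [conj1 h1 h2 hb, conj1 h3 h4 hb] at e
  have hhp : S.gs h = p.rng := by rw [h4, hb]
  have e := comp_cancel (by rw [pact_rng hp.symm, h1]) (by rw [pact_rng hhp, h3]) (fIdem_inj e)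
  rw [pact_mul hig hp.symm, e, ← pact_mul (by rw [S.gs_inv]) hhp, S.inv_mul', pact_one hhp]

theorem evr_quasi (hE : CondEvr S) : (sgeSem S).QuasiFund := by
  rintro s t hs ht hs0 ht0 H
  obtain _ | ⟨α, g, β⟩ := s
  · exact absurd rfl hs0
  obtain _ | ⟨γ, h, δ⟩ := t
  · exact absurd rfl ht0
  obtain ⟨h1, h2⟩ := hs
  obtain ⟨h3, h4⟩ := ht
  obtain ⟨rfl, rfl, hf⟩ := conj_eq_facts h1 h2 h3 h4 (fun p => H _ ((nz_iff _).2 ⟨p, rfl⟩))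
  obtain ⟨μ, m1, m2, m3⟩ := hE _ hf
  have hig : S.gs (S.inv h) = S.gr g := by rw [S.gs_inv, h3, h1]
  rw [S.gs_mul _ _ hig] at m1
  have hb : β.src = μ.rng := by rw [← m1, h2]
  have hg : g = S.mul h (S.mul (S.inv h) g) := by
    rw [← S.mul_assoc' _ _ _ (by rw [S.gr_inv]) hig, S.mul_inv', one_mul'' (by rw [h3, h1])]
  have hk : S.gs h = S.gr (S.mul (S.inv h) g) := by rw [S.gr_mul _ _ hig, S.gr_inv]
  have hk' : S.gs (S.mul (S.inv h) g) = μ.rng := by rw [S.gs_mul _ _ hig, m1]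
  have hhm : S.gs h = μ.rng := by rw [h4, hb]
  have ea : pact S g μ = pact S h μ := by
    conv_lhs => rw [hg]
    rw [pact_mul hk hk', m2]
  have er : pres S g μ = pres S h μ := by
    conv_lhs => rw [hg]
    rw [pres_mul hk hk', m2, m3, mul_one'' (gs_pres hhm).symm]
  have hca : α.src = (pact S g μ).rng := by rw [pact_rng m1, h1]
  have w1 : S.gr (pres S g μ) = (α.comp (pact S g μ)).src := by rw [comp_src hca, pact_src m1]
  have w2 : S.gs (pres S g μ) = (β.comp μ).src := by rw [comp_src hb, gs_pres m1]
  refine ⟨some (α.comp (pact S g μ), pres S g μ, β.comp μ), ⟨w1, w2⟩, by simp [sgeSem], ?_, ?_⟩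
  · rw [le_iff rfl rfl h1 h2 w1 w2]
    exact ⟨μ, hb, rfl, rfl, rfl⟩
  · rw [le_iff rfl rfl h3 h4 w1 w2]
    exact ⟨μ, hb, rfl, by rw [ea], er⟩

theorem faithful_fund (hE : ∀ g : S.G, FixesAll S g → IsUnitArrow S g) : (sgeSem S).Fund := by
  rintro s t hs ht H
  have H' : ∀ p : Path S, _ := fun p => H _ ((nz_iff _).2 ⟨p, rfl⟩)
  obtain _ | ⟨α, g, β⟩ := s
  · obtain _ | ⟨γ, h, δ⟩ := t
    · rfl
    · obtain ⟨h3, h4⟩ := ht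
      have e : none = _ := (H' δ).trans (conj_self h3 h4)
      exact absurd e.symm (fIdem_ne _)
  obtain _ | ⟨γ, h, δ⟩ := t
  · obtain ⟨h3, h4⟩ := hs
    have e : none = _ := (H' β).symm.trans (conj_self h3 h4)
    exact absurd e.symm (fIdem_ne _)
  obtain ⟨h1, h2⟩ := hs
  obtain ⟨h3, h4⟩ := ht
  obtain ⟨rfl, rfl, hf⟩ := conj_eq_facts h1 h2 h3 h4 H'
  have hu := hE _ hf
  have hig : S.gs (S.inv h) = S.gr g := by rw [S.gs_inv, h3, h1]
  unfold IsUnitArrow at hu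
  rw [S.gs_mul _ _ hig] at hu
  have : S.inv h = S.inv g := inv_unique hig hu
  have : g = h := by rw [← inv_inv' g, ← this, inv_inv']
  rw [this]

theorem fixesAll_gr {g : S.G} (hf : FixesAll S g) : S.gr g = S.gs g := by
  have := hf (Path.vert S (S.gs g)) rfl
  rw [pact_vert] at this
  exact congrArg Path.rng this

theorem prefix_vert {γ : Path S} {v : S.V}
    (h : IsPrefix S (Path.vert S v) γ ∨ IsPrefix S γ (Path.vert S v)) : v = γ.rng := by
  rcases h with ⟨r, hr, rfl⟩ | ⟨r, hr, hc⟩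
  · rw [comp_rng]; rfl
  · have := congrArg Path.rng hc
    rwa [comp_rng] at this

theorem conj_vert {g : S.G} (hf : FixesAll S g) {p : Path S} (hp : S.gs g = p.rng) :
    sgeMul S (sgeMul S (some (Path.vert S (S.gs g), g, Path.vert S (S.gs g))) (fIdem S p))
      (sgeStar S (some (Path.vert S (S.gs g), g, Path.vert S (S.gs g)))) = fIdem S p := by
  have := conj1 (α := Path.vert S (S.gs g)) (β := Path.vert S (S.gs g)) (μ := p)
    (fixesAll_gr hf) rfl hp
  rwa [hf p hp.symm, vert_comp hp] at this

theorem one_fixesAll (v : S.V) : FixesAll S (S.one v) := by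
  intro p hp
  rw [S.gs_one] at hp
  exact pact_one hp.symm

theorem conj_vert_eq {g : S.G} (hf : FixesAll S g) (p : Path S) :
    sgeMul S (sgeMul S (some (Path.vert S (S.gs g), g, Path.vert S (S.gs g))) (fIdem S p))
      (sgeStar S (some (Path.vert S (S.gs g), g, Path.vert S (S.gs g)))) =
    sgeMul S (sgeMul S (fIdem S (Path.vert S (S.gs g))) (fIdem S p))
      (sgeStar S (fIdem S (Path.vert S (S.gs g)))) := by
  by_cases hp : S.gs g = p.rng
  · have := conj_vert (one_fixesAll (S.gs g)) (p := p) (by rw [S.gs_one, hp])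
    rw [S.gs_one] at this
    rw [conj_vert hf hp]
    exact this.symm
  · have hn : ¬ (IsPrefix S (Path.vert S (S.gs g)) p ∨ IsPrefix S p (Path.vert S (S.gs g))) :=
      fun h => hp (prefix_vert h)
    rw [not_or] at hn
    rw [conj3 hn.1 hn.2]
    exact (conj3 hn.1 hn.2).symm

theorem fund_faithful (hF : (sgeSem S).Fund) (g : S.G) (hf : FixesAll S g) : IsUnitArrow S g := by
  have := hF (some (Path.vert S (S.gs g), g, Path.vert S (S.gs g)))
    (fIdem S (Path.vert S (S.gs g))) ⟨fixesAll_gr hf, rfl⟩ (fIdem_wf _) (by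
      intro e he
      obtain ⟨p, rfl⟩ := (nz_iff _).1 he
      exact conj_vert_eq hf p)
  simp only [fIdem, Option.some.injEq, Prod.mk.injEq] at this
  exact this.2.1

theorem le_vert {R : RawSem (SGE S)} (hm : R.mul = sgeMul S) (hs : R.star = sgeStar S)
    {g k : S.G} (hg : S.gr g = S.gs g) {α β : Path S} (h1 : S.gr k = α.src) (h2 : S.gs k = β.src)
    (h : R.le (some (α, k, β)) (some (Path.vert S (S.gs g), g, Path.vert S (S.gs g)))) :
    S.gs g = β.rng ∧ α = pact S g β ∧ k = pres S g β := by
  rw [le_iff hm hs (by exact hg) rfl h1 h2] at h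
  obtain ⟨μ, m1, m2, m3, m4⟩ := h
  replace m1 : S.gs g = μ.rng := m1
  rw [vert_comp m1] at m2
  rw [vert_comp (by rw [pact_rng m1, hg])] at m3
  subst m2
  exact ⟨m1, m3, m4⟩

theorem quasi_evr (hF : (sgeSem S).QuasiFund) : CondEvr S := by
  intro g hf
  obtain ⟨u, hu, hu0, l1, l2⟩ := hF (some (Path.vert S (S.gs g), g, Path.vert S (S.gs g)))
    (fIdem S (Path.vert S (S.gs g))) ⟨fixesAll_gr hf, rfl⟩ (fIdem_wf _) (by simp [sgeSem])
    (fIdem_ne _) (by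
      intro e he
      obtain ⟨p, rfl⟩ := (nz_iff _).1 he
      exact conj_vert_eq hf p)
  obtain _ | ⟨α, k, β⟩ := u
  · exact absurd rfl hu0
  obtain ⟨h1, h2⟩ := hu
  obtain ⟨a1, a2, a3⟩ := le_vert rfl rfl (fixesAll_gr hf) h1 h2 l1
  have l2' : (sgeSem S).le (some (α, k, β)) (some (Path.vert S (S.gs (S.one (S.gs g))),
      S.one (S.gs g), Path.vert S (S.gs (S.one (S.gs g))))) := by
    rw [S.gs_one]; exact l2
  obtain ⟨b1, b2, b3⟩ := le_vert rfl rfl (by rw [S.gr_one, S.gs_one]) h1 h2 l2'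
  rw [pact_one a1] at b2
  rw [pres_one a1] at b3
  exact ⟨β, a1, by rw [← a2, b2], by rw [← a3, b3]⟩

theorem evr_top0 (hE : CondEvr S) : (sgeSem0 S).TopFree := by
  rintro t e ht he hfix
  obtain ⟨γ, rfl⟩ := (nz0_iff _).1 he
  -- reformulate the fixing hypothesis
  have hfix' : ∀ p : Path S, IsPrefix S γ p →
      sgeMul S (sgeMul S (sgeMul S t (fIdem S p)) (sgeStar S t)) (fIdem S p) ≠ none := by
    intro p hp
    exact hfix _ ((nz0_iff _).2 ⟨p, rfl⟩) ((fIdem_le_iff rfl rfl).2 hp)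
  clear hfix
  have hγγ : IsPrefix S γ γ := ⟨Path.vert S γ.src, rfl, (comp_vert rfl).symm⟩
  obtain _ | ⟨α, g, β⟩ := t
  · exact absurd rfl (hfix' γ hγγ)
  obtain ⟨⟨h1, h2⟩, h3⟩ := ht
  have hl : α.length = β.length := by
    rcases h3 with h3 | ⟨a, b, c, h, hl⟩
    · simp at h3
    · simp only [Option.some.injEq, Prod.mk.injEq] at h
      rw [h.1, h.2.2, hl]
  -- a common extension
  have hex : ∃ β₁ : Path S, β.src = β₁.rng ∧ IsPrefix S γ (β.comp β₁) := by
    have hne : sgeMul S (sgeMul S (some (α, g, β)) (fIdem S γ))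
        (sgeStar S (some (α, g, β))) ≠ none := by
      intro h
      apply hfix' γ hγγ
      rw [h]; rfl
    rcases conj_ne hne with ⟨r, hr, hc⟩ | h
    · exact ⟨r, hr, hc ▸ hγγ⟩
    · exact ⟨Path.vert S β.src, rfl, by rwa [comp_vert rfl]⟩
  obtain ⟨β₁, hb, ρ, hρ, hc⟩ := hex
  have hext : ∀ ν : Path S, β₁.src = ν.rng → IsPrefix S γ (β.comp (β₁.comp ν)) := by
    intro ν hν
    have hs : (β.comp β₁).src = (γ.comp ρ).src := by rw [hc]
    rw [comp_src hb, comp_src hρ] at hs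
    have hs : ρ.src = ν.rng := by rw [← hs, hν]
    exact ⟨ρ.comp ν, by rw [comp_rng, hρ], by rw [← comp_assoc hb hν, hc, comp_assoc hρ hs]⟩
  -- everything below is fixed
  have hfx : ∀ ν : Path S, β₁.src = ν.rng → α = β ∧ pact S g (β₁.comp ν) = β₁.comp ν := by
    intro ν hν
    have hr : β.src = (β₁.comp ν).rng := by rw [comp_rng, hb]
    have hg : S.gs g = (β₁.comp ν).rng := by rw [h2, hr]
    have hr' : α.src = (pact S g (β₁.comp ν)).rng := by rw [pact_rng hg, h1]
    have := hfix' _ (hext ν hν)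
    rw [conj1 h1 h2 hr, fIdem_mul_ne_iff] at this
    have hll : (α.comp (pact S g (β₁.comp ν))).length = (β.comp (β₁.comp ν)).length := by
      rw [comp_length hr, comp_length hr', pact_length hg, hl]
    have heq : α.comp (pact S g (β₁.comp ν)) = β.comp (β₁.comp ν) := by
      rcases this with ⟨r, a1, a2⟩ | ⟨r, a1, a2⟩
      · have a3 := congrArg Path.length a2
        rw [comp_length a1] at a3
        have : r = Path.vert S r.rng := eq_vert (by omega)
        rw [a2, this, comp_vert a1]
      · have a3 := congrArg Path.length a2
        rw [comp_length a1] at a3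
        have : r = Path.vert S r.rng := eq_vert (by omega)
        rw [a2, this, comp_vert a1]
    exact comp_inj hr' hr hl heq
  have hgb : S.gs g = β₁.rng := by rw [h2, hb]
  obtain ⟨rfl, hb1⟩ := hfx (Path.vert S β₁.src) rfl
  rw [comp_vert rfl] at hb1
  have hk : FixesAll S (pres S g β₁) := by
    intro ν hν
    rw [gs_pres hgb] at hν
    have e := (hfx ν hν.symm).2
    rw [pact_comp hν.symm hgb, hb1] at e
    refine comp_cancel ?_ hν.symm e
    rw [pact_rng (by rw [gs_pres hgb, hν]), ← pact_src hgb, hb1]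
  obtain ⟨ν, n1, n2, n3⟩ := hE _ hk
  rw [gs_pres hgb] at n1
  have hr : α.src = (β₁.comp ν).rng := by rw [comp_rng, hb]
  refine ⟨fIdem S (α.comp (β₁.comp ν)), ⟨(nz0_iff _).2 ⟨_, rfl⟩, ?_⟩, ?_⟩
  · unfold fIdem
    rw [le_iff rfl rfl h1 h2 (S.gr_one _) (S.gs_one _)]
    refine ⟨β₁.comp ν, hr, rfl, by rw [(hfx ν n1).2], ?_⟩
    rw [pres_comp n1 hgb, n3, comp_src hr, comp_src n1]
  · exact fIdem_mul_ne (Or.inr (hext ν n1))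

theorem dom00_dom0 {t : SGE S} (h : domS00 S t) : domS0 S t := by
  refine ⟨h.1, ?_⟩
  rcases h.2 with h | ⟨g, β, hg, rfl⟩
  · exact Or.inl h
  · exact Or.inr ⟨_, _, _, rfl, pact_length hg⟩

theorem nz_eq (e : SGE S) : (sgeSem0 S).NzIdem e ↔ (sgeSem00 S).NzIdem e := by
  rw [nz0_iff, nz00_iff]

theorem top0_top00 (h : (sgeSem0 S).TopFree) : (sgeSem00 S).TopFree := by
  intro t e ht he hfix
  obtain ⟨f, ⟨f1, f2⟩, f3⟩ := h t e (dom00_dom0 ht) ((nz_eq e).2 he)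
    (fun f hf hl => hfix f ((nz_eq f).1 hf) hl)
  exact ⟨f, ⟨(nz_eq f).1 f1, f2⟩, f3⟩

theorem top00_evr (h : (sgeSem00 S).TopFree) : CondEvr S := by
  intro g hf
  obtain ⟨f, ⟨f1, f2⟩, -⟩ := h (some (Path.vert S (S.gs g), g, Path.vert S (S.gs g)))
    (fIdem S (Path.vert S (S.gs g)))
    ⟨⟨fixesAll_gr hf, rfl⟩, Or.inr ⟨g, Path.vert S (S.gs g), rfl, by
      rw [hf _ rfl, pres_vert]⟩⟩ ((nz00_iff _).2 ⟨_, rfl⟩) (by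
      intro f hf' hl
      obtain ⟨p, rfl⟩ := (nz00_iff _).1 hf'
      have hp := prefix_vert (Or.inl ((fIdem_le_iff rfl rfl).1 hl))
      have e := conj_vert hf hp
      have e2 : ∀ x : SGE S, x = fIdem S p → sgeMul S x (fIdem S p) ≠ none := by
        rintro x rfl
        rw [fIdem_mul_self]
        exact fIdem_ne p
      exact e2 _ e)
  obtain ⟨p, rfl⟩ := (nz00_iff _).1 f1
  obtain ⟨a1, a2, a3⟩ := le_vert rfl rfl (fixesAll_gr hf) (S.gr_one _) (S.gs_one _) f2
  exact ⟨p, a1, a2.symm, a3.symm⟩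

end SSA

/-- Condition (Evr) is equivalent to quasi-fundamentality of
`S(G,E)` and to topological freeness of `S₀(G,E)` and of `S₀₀(G,E)`; moreover,
`S(G,E)` is fundamental iff the self-similar action is faithful. -/
theorem statement5 (S : SSA) :
    List.TFAE [SSA.CondEvr S, (SSA.sgeSem S).QuasiFund, (SSA.sgeSem0 S).TopFree,
      (SSA.sgeSem00 S).TopFree] ∧
    ((SSA.sgeSem S).Fund ↔ ∀ g : S.G, SSA.FixesAll S g → SSA.IsUnitArrow S g) := by
  refine ⟨?_, SSA.fund_faithful, SSA.faithful_fund⟩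
  tfae_have 1 → 2 := SSA.evr_quasi
  tfae_have 2 → 1 := SSA.quasi_evr
  tfae_have 1 → 3 := SSA.evr_top0
  tfae_have 3 → 4 := SSA.top0_top00
  tfae_have 4 → 1 := SSA.top00_evr
  tfae_finish

end
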